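/- Let a : ℤ² → ℝ be finitely supported, and f = Σ a[n1,n2]·𝟙_{E_{n1,n2}} a linear combination of square pixels of side 2^{−n}. Then the total variation norm of the distributional derivative (I⊗D)f equals 2^{−n}·Σ_{(n1,n2)} |a[n1,n2] − a[n1,n2+1]|, and similarly ‖(D⊗I)f‖_M = 2^{−n}·Σ |a[n1,n2] − a[n1+1,n2]|. -/

import Mathlib

open MeasureTheory Set Filter

noncomputable section

abbrev K2 : Set (ℝ × ℝ) := Icc (0:ℝ) 1 ×ˢ Icc (0:ℝ) 1

def TV (m : SignedMeasure (ℝ × ℝ)) : ℝ := (m.totalVariation univ).toReal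

def sInt (m : SignedMeasure (ℝ × ℝ)) (φ : ℝ × ℝ → ℝ) : ℝ :=
  ∫ x, φ x ∂m.toJordanDecomposition.posPart - ∫ x, φ x ∂m.toJordanDecomposition.negPart

def IsTest (φ : ℝ × ℝ → ℝ) : Prop := ContDiff ℝ (⊤ : ℕ∞) φ ∧ HasCompactSupport φ

def pd1 (φ : ℝ × ℝ → ℝ) : ℝ × ℝ → ℝ := fun x => fderiv ℝ φ x (1, 0)
def pd2 (φ : ℝ × ℝ → ℝ) : ℝ × ℝ → ℝ := fun x => fderiv ℝ φ x (0, 1)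

def IsDeriv1 (f : ℝ × ℝ → ℝ) (ν : SignedMeasure (ℝ × ℝ)) : Prop :=
  ∀ φ, IsTest φ → ∫ x, f x * pd1 φ x = - sInt ν φ

def IsDeriv2 (f : ℝ × ℝ → ℝ) (ν : SignedMeasure (ℝ × ℝ)) : Prop :=
  ∀ φ, IsTest φ → ∫ x, f x * pd2 φ x = - sInt ν φ

def IsMixedDeriv (f : ℝ × ℝ → ℝ) (m : SignedMeasure (ℝ × ℝ)) : Prop :=
  ∀ φ, IsTest φ → ∫ x, f x * pd1 (pd2 φ) x = sInt m φ

def SuppIn (m : SignedMeasure (ℝ × ℝ)) (s : Set (ℝ × ℝ)) : Prop :=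
  m.totalVariation sᶜ = 0

def MemM0 (f : ℝ × ℝ → ℝ) (m : SignedMeasure (ℝ × ℝ)) : Prop :=
  IsMixedDeriv f m ∧ SuppIn m K2 ∧ (∀ x ∉ K2, f x = 0) ∧
  (∀ᵐ x : ℝ × ℝ, f x = m (Icc 0 x.1 ×ˢ Icc 0 x.2))

def Nmix (θ : ℝ) (m ν₁ ν₂ : SignedMeasure (ℝ × ℝ)) : ℝ :=
  θ * TV m + (1 - θ) * (TV ν₁ + TV ν₂)

def ind (A : Set (ℝ × ℝ)) : ℝ × ℝ → ℝ := A.indicator (fun _ => 1)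

def h11 (a : ℤ × ℤ → ℝ) (p : ℤ × ℤ) : ℝ :=
  a p - a (p.1 + 1, p.2) - a (p.1, p.2 + 1) + a (p.1 + 1, p.2 + 1)

def h10 (a : ℤ × ℤ → ℝ) (p : ℤ × ℤ) : ℝ := a p - a (p.1 + 1, p.2)

def h01 (a : ℤ × ℤ → ℝ) (p : ℤ × ℤ) : ℝ := a p - a (p.1, p.2 + 1)

def cell (n : ℕ) (p : ℤ × ℤ) : Set (ℝ × ℝ) :=
  Icc (((p.1 : ℝ) - 1) * (2:ℝ) ^ (-(n:ℤ))) ((p.1 : ℝ) * (2:ℝ) ^ (-(n:ℤ))) ×ˢ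
  Icc (((p.2 : ℝ) - 1) * (2:ℝ) ^ (-(n:ℤ))) ((p.2 : ℝ) * (2:ℝ) ^ (-(n:ℤ)))

def pix (n : ℕ) (a : ℤ × ℤ → ℝ) : ℝ × ℝ → ℝ :=
  fun x => ∑' p : ℤ × ℤ, a p * (cell n p).indicator (fun _ => (1:ℝ)) x

/-- Finite measures on a finite-dimensional space are determined by their integrals against
smooth compactly supported functions. -/
theorem measure_ext_of_integral_contDiff {E : Type*} [NormedAddCommGroup E] [NormedSpace ℝ E]
    [FiniteDimensional ℝ E] [MeasurableSpace E] [BorelSpace E] {μ ν : Measure E}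
    [IsFiniteMeasure μ] [IsFiniteMeasure ν]
    (h : ∀ φ : E → ℝ, ContDiff ℝ (⊤ : ℕ∞) φ → HasCompactSupport φ → ∫ x, φ x ∂μ = ∫ x, φ x ∂ν) :
    μ = ν := by
  have hμ : μ ≪ μ + ν := Measure.AbsolutelyContinuous.rfl.add_right ν
  have hν : ν ≪ μ + ν := by
    rw [add_comm]; exact Measure.AbsolutelyContinuous.rfl.add_right μ
  have key : ∀ᵐ x ∂(μ + ν),
      (μ.rnDeriv (μ + ν) x).toReal = (ν.rnDeriv (μ + ν) x).toReal := by
    refine ae_eq_of_integral_contDiff_smul_eq Measure.integrable_toReal_rnDeriv.locallyIntegrable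
      Measure.integrable_toReal_rnDeriv.locallyIntegrable fun φ hφ hc => ?_
    simp_rw [smul_eq_mul, mul_comm (φ _)]
    rw [integral_toReal_rnDeriv_mul hμ, integral_toReal_rnDeriv_mul hν]
    exact h φ hφ hc
  refine (Measure.withDensity_rnDeriv_eq μ _ hμ).symm.trans
    (Eq.trans (withDensity_congr_ae ?_) (Measure.withDensity_rnDeriv_eq ν _ hν))
  filter_upwards [key, μ.rnDeriv_ne_top (μ + ν), ν.rnDeriv_ne_top (μ + ν)] with x hx h1 h2
  exact (ENNReal.toReal_eq_toReal_iff' h1 h2).1 hx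

theorem mutuallySingular_finsetSum_left {α ι : Type*} [MeasurableSpace α] {s : Finset ι}
    {μ : ι → Measure α} {ν : Measure α} (h : ∀ i ∈ s, μ i ⟂ₘ ν) : ∑ i ∈ s, μ i ⟂ₘ ν := by
  classical
  induction s using Finset.induction_on with
  | empty => simp
  | insert i s hi ih =>
    rw [Finset.sum_insert hi]
    exact (h i (by simp)).add_left (ih fun j hj => h j (by simp [hj]))

theorem mutuallySingular_posPart_negPart_sum {α ι : Type*} [MeasurableSpace α] (s : Finset ι)
    {σ : ι → Measure α} (hσ : Pairwise fun i j => σ i ⟂ₘ σ j) (c : ι → ℝ) :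
    ∑ i ∈ s, (c i).toNNReal • σ i ⟂ₘ ∑ i ∈ s, (-c i).toNNReal • σ i := by
  refine mutuallySingular_finsetSum_left fun i _ =>
    (mutuallySingular_finsetSum_left fun j _ => ?_).symm
  rcases eq_or_ne j i with rfl | hij
  · rcases le_total (c j) 0 with hc | hc
    · simp [Real.toNNReal_of_nonpos hc]
    · simp [Real.toNNReal_of_nonpos (neg_nonpos.2 hc)]
  · exact ((hσ hij).smul_nnreal _).symm.smul_nnreal _ |>.symm

theorem IsTest.integrable {φ : ℝ × ℝ → ℝ} (hφ : IsTest φ) (μ : Measure (ℝ × ℝ))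
    [IsFiniteMeasure μ] : Integrable φ μ :=
  hφ.1.continuous.integrable_of_hasCompactSupport hφ.2

theorem totalVariation_eq_add_of_sInt_eq {ν : SignedMeasure (ℝ × ℝ)} {P N : Measure (ℝ × ℝ)}
    [IsFiniteMeasure P] [IsFiniteMeasure N] (hPN : P ⟂ₘ N)
    (h : ∀ φ, IsTest φ → sInt ν φ = ∫ x, φ x ∂P - ∫ x, φ x ∂N) :
    ν.totalVariation = P + N := by
  have := ν.toJordanDecomposition.posPart_finite
  have := ν.toJordanDecomposition.negPart_finite
  have hsum : ν.toJordanDecomposition.posPart + N = P + ν.toJordanDecomposition.negPart := by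
    refine measure_ext_of_integral_contDiff fun φ hφ hc => ?_
    have hT : IsTest φ := ⟨hφ, hc⟩
    rw [integral_add_measure (hT.integrable _) (hT.integrable _),
      integral_add_measure (hT.integrable _) (hT.integrable _)]
    have := h φ hT
    rw [sInt] at this
    linarith
  have hj : ν.toJordanDecomposition = ⟨P, N, hPN⟩ := by
    refine SignedMeasure.toJordanDecomposition_eq ?_
    conv_lhs => rw [← ν.toSignedMeasure_toJordanDecomposition]
    rw [JordanDecomposition.toSignedMeasure, JordanDecomposition.toSignedMeasure,
      sub_eq_sub_iff_add_eq_add, ← Measure.toSignedMeasure_add, ← Measure.toSignedMeasure_add]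
    simp only [hsum]
  rw [SignedMeasure.totalVariation, hj]

theorem TV_eq_of_sInt_eq_tsum {ι : Type*} {ν : SignedMeasure (ℝ × ℝ)}
    {σ : ι → Measure (ℝ × ℝ)} [∀ i, IsFiniteMeasure (σ i)]
    (hσ : Pairwise fun i j => σ i ⟂ₘ σ j) {δ : ℝ} (hδ : ∀ i, (σ i).real univ = δ)
    {c : ι → ℝ} (hc : (Function.support c).Finite)
    (h : ∀ φ, IsTest φ → sInt ν φ = - ∑' i, c i * ∫ x, φ x ∂σ i) :
    TV ν = δ * ∑' i, |c i| := by
  classical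
  have hcs : ∀ i ∉ hc.toFinset, c i = 0 := fun i hi => by simpa using hi
  have hint : ∀ φ, IsTest φ → ∀ b : ι → ℝ,
      ∫ x, φ x ∂(∑ i ∈ hc.toFinset, (b i).toNNReal • σ i)
        = ∑ i ∈ hc.toFinset, max (b i) 0 * ∫ x, φ x ∂σ i := by
    intro φ hφ b
    rw [integral_finsetSum_measure fun i _ => hφ.integrable _]
    refine Finset.sum_congr rfl fun i _ => ?_
    rw [integral_smul_nnreal_measure, NNReal.smul_def, Real.coe_toNNReal', smul_eq_mul]
  have htv := totalVariation_eq_add_of_sInt_eq (ν := ν)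
    (mutuallySingular_posPart_negPart_sum hc.toFinset hσ c).symm fun φ hφ => by
      rw [h φ hφ, tsum_eq_sum (s := hc.toFinset) fun i hi => by rw [hcs i hi, zero_mul],
        hint φ hφ c, hint φ hφ fun i => -c i, ← Finset.sum_sub_distrib, ← Finset.sum_neg_distrib]
      refine Finset.sum_congr rfl fun i _ => ?_
      rw [← sub_mul, ← neg_mul]
      congr 1
      rcases le_total (c i) 0 with hi | hi
      · simp [hi]
      · simp [hi]
  have hreal : ∀ b : ι → ℝ, (∑ i ∈ hc.toFinset, (b i).toNNReal • σ i).real univ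
      = ∑ i ∈ hc.toFinset, max (b i) 0 * δ := by
    intro b
    rw [measureReal_def, Measure.finsetSum_apply, ENNReal.toReal_sum fun i _ => measure_ne_top _ _]
    refine Finset.sum_congr rfl fun i _ => ?_
    rw [← measureReal_def, measureReal_nnreal_smul_apply, hδ, Real.coe_toNNReal']
  rw [TV, htv, ← measureReal_def, measureReal_add_apply, hreal c, hreal fun i => -c i,
    tsum_eq_sum (s := hc.toFinset) fun i hi => by rw [hcs i hi, abs_zero], Finset.mul_sum,
    ← Finset.sum_add_distrib]
  refine Finset.sum_congr rfl fun i _ => ?_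
  rcases le_total (c i) 0 with hi | hi
  · simp [hi, abs_of_nonpos, mul_comm]
  · simp [hi, abs_of_nonneg, mul_comm]

theorem tsum_mul_sub_translate {G : Type*} [AddCommGroup G] {a : G → ℝ}
    (ha : (Function.support a).Finite) (A : G → ℝ) (e : G) :
    ∑' p, a p * (A p - A (p - e)) = ∑' p, (a p - a (p + e)) * A p := by
  have hs : ∀ B : G → ℝ, Summable fun p => a p * B p := fun B =>
    summable_of_hasFiniteSupport (ha.subset (Function.support_mul_subset_left _ _))
  have hshift : (fun p => a (p + e) * A p) = (fun p => a p * A (p - e)) ∘ Equiv.addRight e := by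
    ext p; simp
  simp_rw [mul_sub, sub_mul]
  rw [(hs A).tsum_sub (hs fun p => A (p - e)), (hs A).tsum_sub, hshift,
    ← (Equiv.addRight e).tsum_eq fun p => a p * A (p - e)]
  · rfl
  · rw [hshift]; exact (Equiv.addRight e).summable_iff.2 (hs fun p => A (p - e))

theorem finite_support_sub_translate {G : Type*} [AddGroup G] {a : G → ℝ}
    (ha : (Function.support a).Finite) (e : G) :
    (Function.support fun p => a p - a (p + e)).Finite := by
  refine (ha.union (ha.preimage ((add_left_injective e).injOn))).subset fun p hp => ?_
  by_contra hn
  simp only [mem_union, mem_preimage, Function.mem_support, not_or, not_not] at hn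
  exact hp (by simp [hn.1, hn.2])

/-- Arc length on the upper edge of a pixel. -/
def topEdge (δ : ℝ) (p : ℤ × ℤ) : Measure (ℝ × ℝ) :=
  (volume.restrict (Ioc (((p.1 : ℝ) - 1) * δ) (p.1 * δ))).map fun t => (t, (p.2 : ℝ) * δ)

/-- Arc length on the right edge of a pixel. -/
def rightEdge (δ : ℝ) (p : ℤ × ℤ) : Measure (ℝ × ℝ) :=
  (volume.restrict (Ioc (((p.2 : ℝ) - 1) * δ) (p.2 * δ))).map fun t => ((p.1 : ℝ) * δ, t)

instance (δ : ℝ) (p : ℤ × ℤ) : IsFiniteMeasure (topEdge δ p) := by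
  unfold topEdge; infer_instance

instance (δ : ℝ) (p : ℤ × ℤ) : IsFiniteMeasure (rightEdge δ p) := by
  unfold rightEdge; infer_instance

theorem disjoint_grid_Ioc {δ : ℝ} (hδ : 0 < δ) {i j : ℤ} (hij : i ≠ j) :
    Disjoint (Ioc (((i : ℝ) - 1) * δ) (i * δ)) (Ioc (((j : ℝ) - 1) * δ) (j * δ)) := by
  rw [Set.disjoint_left]
  rintro x ⟨h1, h2⟩ ⟨h3, h4⟩
  have h5 := lt_of_mul_lt_mul_right (h1.trans_le h4) hδ.le
  have h6 := lt_of_mul_lt_mul_right (h3.trans_le h2) hδ.le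
  have h7 : i - 1 < j := by exact_mod_cast h5
  have h8 : j - 1 < i := by exact_mod_cast h6
  omega

theorem mutuallySingular_of_disjoint {α : Type*} [MeasurableSpace α] {μ ν : Measure α}
    {s t : Set α} (hs : μ sᶜ = 0) (ht : ν tᶜ = 0) (hst : Disjoint s t) : μ ⟂ₘ ν :=
  Measure.MutuallySingular.mk hs ht fun x _ => by
    by_cases hx : x ∈ s
    · exact Or.inr fun hxt => Set.disjoint_left.1 hst hx hxt
    · exact Or.inl hx

theorem topEdge_compl (δ : ℝ) (p : ℤ × ℤ) :
    topEdge δ p (Ioc (((p.1 : ℝ) - 1) * δ) (p.1 * δ) ×ˢ {(p.2 : ℝ) * δ})ᶜ = 0 := by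
  rw [topEdge, Measure.map_apply (by fun_prop)
    (measurableSet_Ioc.prod (measurableSet_singleton _)).compl,
    Measure.restrict_apply' measurableSet_Ioc]
  convert measure_empty (μ := (volume : Measure ℝ))
  ext t
  simp +contextual

theorem rightEdge_compl (δ : ℝ) (p : ℤ × ℤ) :
    rightEdge δ p ({(p.1 : ℝ) * δ} ×ˢ Ioc (((p.2 : ℝ) - 1) * δ) (p.2 * δ))ᶜ = 0 := by
  rw [rightEdge, Measure.map_apply (by fun_prop)
    ((measurableSet_singleton _).prod measurableSet_Ioc).compl,
    Measure.restrict_apply' measurableSet_Ioc]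
  convert measure_empty (μ := (volume : Measure ℝ))
  ext t
  simp +contextual

theorem disjoint_grid_singleton {δ : ℝ} (hδ : 0 < δ) {i j : ℤ} (hij : i ≠ j) :
    Disjoint ({(i : ℝ) * δ} : Set ℝ) {(j : ℝ) * δ} := by
  simpa [hδ.ne'] using hij

theorem pairwise_mutuallySingular_topEdge {δ : ℝ} (hδ : 0 < δ) :
    Pairwise fun p q => topEdge δ p ⟂ₘ topEdge δ q := by
  intro p q hpq
  refine mutuallySingular_of_disjoint (topEdge_compl δ p) (topEdge_compl δ q) ?_
  rw [Set.disjoint_prod]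
  by_cases h : p.1 = q.1
  · exact Or.inr (disjoint_grid_singleton hδ fun h' => hpq (Prod.ext h h'))
  · exact Or.inl (disjoint_grid_Ioc hδ h)

theorem pairwise_mutuallySingular_rightEdge {δ : ℝ} (hδ : 0 < δ) :
    Pairwise fun p q => rightEdge δ p ⟂ₘ rightEdge δ q := by
  intro p q hpq
  refine mutuallySingular_of_disjoint (rightEdge_compl δ p) (rightEdge_compl δ q) ?_
  rw [Set.disjoint_prod]
  by_cases h : p.1 = q.1
  · exact Or.inr (disjoint_grid_Ioc hδ fun h' => hpq (Prod.ext h h'))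
  · exact Or.inl (disjoint_grid_singleton hδ h)

theorem measureReal_topEdge_univ {δ : ℝ} (hδ : 0 < δ) (p : ℤ × ℤ) :
    (topEdge δ p).real univ = δ := by
  rw [topEdge, map_measureReal_apply (by fun_prop) MeasurableSet.univ, preimage_univ,
    measureReal_restrict_apply_univ, Real.volume_real_Ioc_of_le (by nlinarith)]
  ring

theorem measureReal_rightEdge_univ {δ : ℝ} (hδ : 0 < δ) (p : ℤ × ℤ) :
    (rightEdge δ p).real univ = δ := by
  rw [rightEdge, map_measureReal_apply (by fun_prop) MeasurableSet.univ, preimage_univ,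
    measureReal_restrict_apply_univ, Real.volume_real_Ioc_of_le (by nlinarith)]
  ring

theorem integral_topEdge {φ : ℝ × ℝ → ℝ} (hφ : Continuous φ) (δ : ℝ) (p : ℤ × ℤ) :
    ∫ x, φ x ∂topEdge δ p
      = ∫ t in Icc (((p.1 : ℝ) - 1) * δ) (p.1 * δ), φ (t, (p.2 : ℝ) * δ) := by
  rw [topEdge, integral_map (by fun_prop) hφ.aestronglyMeasurable, integral_Icc_eq_integral_Ioc]

theorem integral_rightEdge {φ : ℝ × ℝ → ℝ} (hφ : Continuous φ) (δ : ℝ) (p : ℤ × ℤ) :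
    ∫ x, φ x ∂rightEdge δ p
      = ∫ t in Icc (((p.2 : ℝ) - 1) * δ) (p.2 * δ), φ ((p.1 : ℝ) * δ, t) := by
  rw [rightEdge, integral_map (by fun_prop) hφ.aestronglyMeasurable, integral_Icc_eq_integral_Ioc]

theorem IsTest.continuous_pd1 {φ : ℝ × ℝ → ℝ} (hφ : IsTest φ) : Continuous (pd1 φ) :=
  (hφ.1.continuous_fderiv (by simp)).clm_apply continuous_const

theorem IsTest.continuous_pd2 {φ : ℝ × ℝ → ℝ} (hφ : IsTest φ) : Continuous (pd2 φ) :=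
  (hφ.1.continuous_fderiv (by simp)).clm_apply continuous_const

theorem IsTest.setIntegral_pd1 {φ : ℝ × ℝ → ℝ} (hφ : IsTest φ) {a b : ℝ} (hab : a ≤ b) (y : ℝ) :
    ∫ x in Icc a b, pd1 φ (x, y) = φ (b, y) - φ (a, y) := by
  rw [integral_Icc_eq_integral_Ioc, ← intervalIntegral.integral_of_le hab]
  refine intervalIntegral.integral_eq_sub_of_hasDerivAt (f := fun x => φ (x, y)) (fun x _ => ?_)
    ((hφ.continuous_pd1.comp (by fun_prop : Continuous fun x : ℝ => (x, y))).intervalIntegrable _ _)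
  exact (hφ.1.differentiable (by simp) (x, y)).hasFDerivAt.comp_hasDerivAt x
    ((hasDerivAt_id x).prodMk (hasDerivAt_const x y))

theorem IsTest.setIntegral_pd2 {φ : ℝ × ℝ → ℝ} (hφ : IsTest φ) {a b : ℝ} (hab : a ≤ b) (x : ℝ) :
    ∫ y in Icc a b, pd2 φ (x, y) = φ (x, b) - φ (x, a) := by
  rw [integral_Icc_eq_integral_Ioc, ← intervalIntegral.integral_of_le hab]
  refine intervalIntegral.integral_eq_sub_of_hasDerivAt (f := fun y => φ (x, y)) (fun y _ => ?_)
    ((hφ.continuous_pd2.comp (by fun_prop : Continuous fun y : ℝ => (x, y))).intervalIntegrable _ _)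
  exact (hφ.1.differentiable (by simp) (x, y)).hasFDerivAt.comp_hasDerivAt y
    ((hasDerivAt_const y x).prodMk (hasDerivAt_id y))

theorem setIntegral_prod_Icc_symm {f : ℝ × ℝ → ℝ} (hf : Continuous f) (a b c d : ℝ) :
    ∫ z in Icc a b ×ˢ Icc c d, f z = ∫ y in Icc c d, ∫ x in Icc a b, f (x, y) := by
  rw [Measure.volume_eq_prod, ← setIntegral_prod_swap, setIntegral_prod]
  · rfl
  · exact (hf.comp continuous_swap).continuousOn.integrableOn_compact
      (isCompact_Icc.prod isCompact_Icc)

theorem setIntegral_cell_pd1 {φ : ℝ × ℝ → ℝ} (hφ : IsTest φ) (n : ℕ) (p : ℤ × ℤ) :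
    ∫ x in cell n p, pd1 φ x = ∫ x, φ x ∂rightEdge (2 ^ (-(n : ℤ))) p
      - ∫ x, φ x ∂rightEdge (2 ^ (-(n : ℤ))) (p - (1, 0)) := by
  have hδ : (0 : ℝ) < 2 ^ (-(n : ℤ)) := by positivity
  have hcont : ∀ x : ℝ, Continuous fun y => φ (x, y) := fun x => hφ.1.continuous.comp (by fun_prop)
  rw [cell, setIntegral_prod_Icc_symm hφ.continuous_pd1]
  simp_rw [hφ.setIntegral_pd1 (mul_le_mul_of_nonneg_right (sub_le_self _ zero_le_one) hδ.le)]
  rw [integral_sub (hcont _).continuousOn.integrableOn_Icc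
    (hcont _).continuousOn.integrableOn_Icc, integral_rightEdge hφ.1.continuous,
    integral_rightEdge hφ.1.continuous]
  simp

theorem setIntegral_cell_pd2 {φ : ℝ × ℝ → ℝ} (hφ : IsTest φ) (n : ℕ) (p : ℤ × ℤ) :
    ∫ x in cell n p, pd2 φ x = ∫ x, φ x ∂topEdge (2 ^ (-(n : ℤ))) p
      - ∫ x, φ x ∂topEdge (2 ^ (-(n : ℤ))) (p - (0, 1)) := by
  have hδ : (0 : ℝ) < 2 ^ (-(n : ℤ)) := by positivity
  have hcont : ∀ y : ℝ, Continuous fun x => φ (x, y) := fun y => hφ.1.continuous.comp (by fun_prop)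
  rw [cell, Measure.volume_eq_prod, setIntegral_prod _
    (hφ.continuous_pd2.continuousOn.integrableOn_compact (isCompact_Icc.prod isCompact_Icc))]
  simp_rw [hφ.setIntegral_pd2 (mul_le_mul_of_nonneg_right (sub_le_self _ zero_le_one) hδ.le)]
  rw [integral_sub (hcont _).continuousOn.integrableOn_Icc
    (hcont _).continuousOn.integrableOn_Icc, integral_topEdge hφ.1.continuous,
    integral_topEdge hφ.1.continuous]
  simp

theorem integral_pix_mul {a : ℤ × ℤ → ℝ} (ha : (Function.support a).Finite) (n : ℕ)
    {g : ℝ × ℝ → ℝ} (hg : Continuous g) :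
    ∫ x, pix n a x * g x = ∑' p, a p * ∫ x in cell n p, g x := by
  have h0 : ∀ p ∉ ha.toFinset, a p = 0 := fun p hp => by simpa using hp
  have hm : ∀ p, MeasurableSet (cell n p) := fun p => measurableSet_Icc.prod measurableSet_Icc
  have hpix : ∀ x, pix n a x * g x = ∑ p ∈ ha.toFinset, a p * (cell n p).indicator g x := by
    intro x
    rw [pix, tsum_eq_sum (s := ha.toFinset) fun p hp => by rw [h0 p hp, zero_mul],
      Finset.sum_mul]
    refine Finset.sum_congr rfl fun p _ => ?_
    by_cases hx : x ∈ cell n p <;> simp [hx]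
  simp_rw [hpix]
  rw [integral_finsetSum, tsum_eq_sum (s := ha.toFinset) fun p hp => by rw [h0 p hp, zero_mul]]
  · refine Finset.sum_congr rfl fun p _ => ?_
    rw [integral_const_mul, integral_indicator (hm p)]
  · intro p _
    exact ((integrable_indicator_iff (hm p)).2 (hg.continuousOn.integrableOn_compact
      (isCompact_Icc.prod isCompact_Icc))).const_mul _

theorem stmt12 (n : ℕ) (a : ℤ × ℤ → ℝ) (ha : (Function.support a).Finite)
    (ν₁ ν₂ : SignedMeasure (ℝ × ℝ))
    (h1 : IsDeriv1 (pix n a) ν₁) (h2 : IsDeriv2 (pix n a) ν₂) :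
    TV ν₂ = (2:ℝ) ^ (-(n:ℤ)) * ∑' p : ℤ × ℤ, |h01 a p| ∧
    TV ν₁ = (2:ℝ) ^ (-(n:ℤ)) * ∑' p : ℤ × ℤ, |h10 a p| := by
  have hδ : (0 : ℝ) < 2 ^ (-(n : ℤ)) := by positivity
  have e01 : h01 a = fun p => a p - a (p + (0, 1)) := by
    ext p; simp [h01, Prod.add_def]
  have e10 : h10 a = fun p => a p - a (p + (1, 0)) := by
    ext p; simp [h10, Prod.add_def]
  rw [e01, e10]
  constructor
  · refine TV_eq_of_sInt_eq_tsum (pairwise_mutuallySingular_topEdge hδ)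
      (measureReal_topEdge_univ hδ) (finite_support_sub_translate ha _) fun φ hφ => ?_
    rw [← tsum_mul_sub_translate ha (fun p => ∫ x, φ x ∂topEdge (2 ^ (-(n : ℤ))) p),
      ← neg_eq_iff_eq_neg, ← h2 φ hφ, integral_pix_mul ha n hφ.continuous_pd2]
    simp_rw [setIntegral_cell_pd2 hφ]
  · refine TV_eq_of_sInt_eq_tsum (pairwise_mutuallySingular_rightEdge hδ)
      (measureReal_rightEdge_univ hδ) (finite_support_sub_translate ha _) fun φ hφ => ?_
    rw [← tsum_mul_sub_translate ha (fun p => ∫ x, φ x ∂rightEdge (2 ^ (-(n : ℤ))) p),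
      ← neg_eq_iff_eq_neg, ← h1 φ hφ, integral_pix_mul ha n hφ.continuous_pd1]
    simp_rw [setIntegral_cell_pd1 hφ]
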